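/- Let w be a permutation, i ≥ 1, d ≥ 0, and ζ = t_{p₁q₁}⋯t_{p_dq_d} ∈ X_{i,d}(w). Let 1 ≤ a ≤ d and suppose there is no b < a with p_b = p_a. Then m_{p_aq_a}(w_a) = m_{p_aq_a}(w) and m'_{q_ap_a}(w_a) = m'_{q_ap_a}(w), where w_a = w t_{p₁q₁}⋯t_{p_{a−1}q_{a−1}}. -/

import Mathlib

open scoped Classical

noncomputable section

/-- Permutations of the positive integers. -/
abbrev PPerm := Equiv.Perm ℕ+

/-- A permutation fixes all but finitely many points. -/
def HasFinSupp (w : PPerm) : Prop := {k : ℕ+ | w k ≠ k}.Finite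

/-- The transposition `t_{pq}`. -/
def tr (p q : ℕ+) : PPerm := Equiv.swap p q

/-- The set of inversions `I(w)`. -/
def invSet (w : PPerm) : Set (ℕ+ × ℕ+) := {x | x.1 < x.2 ∧ w x.2 < w x.1}

/-- The length `ℓ(w)` (number of inversions). -/
def len (w : PPerm) : ℕ := (invSet w).ncard

/-- `m_{pq}(z) = #{r > q : z(p) < z(r) < z(q)}`. -/
def mCnt (z : PPerm) (p q : ℕ+) : ℕ := {r : ℕ+ | q < r ∧ z p < z r ∧ z r < z q}.ncard

/-- `m'_{qp}(z) = #{r < p : z(p) < z(r) < z(q)}`. -/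
def m'Cnt (z : PPerm) (q p : ℕ+) : ℕ := {r : ℕ+ | r < p ∧ z p < z r ∧ z r < z q}.ncard

/-- The list of transpositions `t_{p₁q₁}, …, t_{p_dq_d}`. -/
def trList (d : ℕ) (p q : Fin d → ℕ+) : List PPerm := List.ofFn fun j => tr (p j) (q j)

/-- `w_{j+1} = w t_{p₁q₁} ⋯ t_{p_jq_j}` (so `wSeq w d p q 0 = w₁ = w`). -/
def wSeq (w : PPerm) (d : ℕ) (p q : Fin d → ℕ+) (j : ℕ) : PPerm :=
  w * ((trList d p q).take j).prod

/-- The defining conditions on a factorization for membership in `X_{i,d}(w)`. -/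
def IsXFact (w : PPerm) (i d : ℕ) (p q : Fin d → ℕ+) : Prop :=
  (∀ j, (p j : ℕ) ≤ i ∧ i < (q j : ℕ)) ∧
  (∀ j : Fin d, len (wSeq w d p q (j + 1)) = len (wSeq w d p q j) + 1) ∧
  (∀ j k : Fin d, j < k → wSeq w d p q j (p j) < wSeq w d p q k (p k))

/-- The defining conditions on a factorization for membership in `Y_{i,d}(w)`. -/
def IsYFact (w : PPerm) (i d : ℕ) (p q : Fin d → ℕ+) : Prop :=
  (∀ j, (p j : ℕ) ≤ i ∧ i < (q j : ℕ)) ∧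
  (∀ j : Fin d, len (wSeq w d p q (j + 1)) = len (wSeq w d p q j) + 1) ∧
  (∀ j k : Fin d, j < k → wSeq w d p q k (q k) < wSeq w d p q j (q j))

/-- The set `X_{i,d}(w)`. -/
def XSet (w : PPerm) (i d : ℕ) : Set PPerm :=
  {ζ | ∃ p q : Fin d → ℕ+, ζ = (trList d p q).prod ∧ IsXFact w i d p q}

/-- The set `Y_{i,d}(w)`. -/
def YSet (w : PPerm) (i d : ℕ) : Set PPerm :=
  {ζ | ∃ p q : Fin d → ℕ+, ζ = (trList d p q).prod ∧ IsYFact w i d p q}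

/-- `w ∈ S^{(n)}`, i.e. `w(n+1) < w(n+2) < ⋯`. -/
def InSn (n : ℕ) (w : PPerm) : Prop := ∀ k l : ℕ+, (n : ℕ) < (k : ℕ) → k < l → w k < w l

/-- `x₁^{m-1} x₂^{m-2} ⋯ x_{m-1}`, the Schubert polynomial of the longest element of `S_m`. -/
def schubBase (m : ℕ) : MvPolynomial ℕ+ ℤ :=
  ∏ k ∈ Finset.range m, MvPolynomial.X (k.succPNat) ^ (m - 1 - k)

/-- The defining property of the family of Schubert polynomials `w ↦ 𝔖_w`:
the value on dominant "staircase" permutations, together with the divided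
difference recursion `𝔖_{w s_i} = ∂_i 𝔖_w` whenever `ℓ(w s_i) < ℓ(w)`, stated
in the product form `(x_i - x_{i+1}) · 𝔖_{w s_i} = 𝔖_w - s_i 𝔖_w`. -/
def IsSchubertFamily (S : PPerm → MvPolynomial ℕ+ ℤ) : Prop :=
  (∀ m : ℕ, ∀ w : PPerm, (∀ k : ℕ+, (k : ℕ) ≤ m → (w k : ℕ) = m + 1 - (k : ℕ)) →
      (∀ k : ℕ+, m < (k : ℕ) → w k = k) → S w = schubBase m) ∧
  (∀ w : PPerm, ∀ i : ℕ+, len (w * tr i (i + 1)) < len w →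
      (MvPolynomial.X i - MvPolynomial.X (i + 1)) * S (w * tr i (i + 1)) =
        S w - MvPolynomial.rename (Equiv.swap i (i + 1)) (S w))

/-- The complete homogeneous symmetric polynomial `h_d(x₁, …, x_i)`. -/
def hPoly (i d : ℕ) : MvPolynomial ℕ+ ℤ :=
  ∑ m : Sym (Fin i) d, ((m : Multiset (Fin i)).map fun k => MvPolynomial.X (k.val.succPNat)).prod

/-- The elementary symmetric polynomial `e_d(x₁, …, x_i)`. -/
def ePoly (i d : ℕ) : MvPolynomial ℕ+ ℤ :=
  ∑ s ∈ Finset.powersetCard d (Finset.univ : Finset (Fin i)),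
    ∏ k ∈ s, MvPolynomial.X (k.val.succPNat)

/-- Lexicographic order on permutations. -/
def lexLT (u v : PPerm) : Prop := ∃ k : ℕ+, (∀ l, l < k → u l = v l) ∧ u k < v k

/-- Reverse lexicographic order on permutations. -/
def rlexLT (u v : PPerm) : Prop := ∃ k : ℕ+, (∀ l, k < l → u l = v l) ∧ u k < v k

theorem finite_invSet {z : PPerm} (hz : HasFinSupp z) : (invSet z).Finite := by
  obtain ⟨N, hN⟩ := hz.bddAbove
  have key : ∀ x ∈ invSet z, x.2 ≤ N := by
    rintro ⟨i, j⟩ ⟨hij, hinv⟩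
    simp only at hij hinv ⊢
    by_contra! hj
    have hfix : ∀ k, N < k → z k = k := fun k hk => by
      by_contra hne
      exact absurd (hN hne) (not_le.mpr hk)
    rw [hfix j hj] at hinv
    have := z.injective (hfix (z i) (hj.trans hinv))
    rw [this] at hinv
    exact absurd hinv (not_lt.mpr hij.le)
  refine ((Set.finite_Iic N).prod (Set.finite_Iic N)).subset fun x hx => ?_
  exact ⟨hx.1.le.trans (key x hx), key x hx⟩

theorem HasFinSupp.mul_tr {z : PPerm} (hz : HasFinSupp z) (p q : ℕ+) :
    HasFinSupp (z * tr p q) := by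
  refine (hz.union (Set.toFinite {p, q})).subset fun k hk => ?_
  by_contra h
  simp only [Set.mem_union, Set.mem_insert_iff, Set.mem_singleton_iff, not_or,
    Set.mem_ofPred_eq, not_not] at h
  apply hk
  rw [Equiv.Perm.mul_apply, tr, Equiv.swap_apply_of_ne_of_ne h.2.1 h.2.2, h.1]

/-- Right multiplication by an ascending transposition embeds inversions into inversions. -/
theorem len_add_ncard_le {z : PPerm} (hz : HasFinSupp z) {p q : ℕ+} (hpq : p < q)
    (hlt : z p < z q) {S : Set ℕ+} (hS : ∀ r ∈ S, p < r ∧ r ≤ q ∧ z p < z r ∧ z r ≤ z q) :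
    len z + S.ncard ≤ len (z * tr p q) := by
  let t := tr p q
  have tt : ∀ k, t (t k) = k := Equiv.swap_apply_self p q
  let f : ℕ+ × ℕ+ → ℕ+ × ℕ+ := fun x => if t x.1 < t x.2 then (t x.1, t x.2) else x
  let g : ℕ+ → ℕ+ × ℕ+ := fun r => (p, r)
  have tp : t p = q := Equiv.swap_apply_left p q
  have tq : t q = p := Equiv.swap_apply_right p q
  have tn : ∀ k, k ≠ p → k ≠ q → t k = k := fun k h h' => Equiv.swap_apply_of_ne_of_ne h h'
  have hf : ∀ x ∈ invSet z, f x ∈ invSet (z * t) := by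
    rintro ⟨i, j⟩ ⟨hij, hinv⟩
    simp only at hij hinv
    simp only [f]
    split_ifs with h
    · exact ⟨h, by simpa only [Equiv.Perm.mul_apply, tt] using hinv⟩
    · refine ⟨hij, ?_⟩
      simp only [Equiv.Perm.mul_apply]
      by_cases h1 : i = p <;> by_cases h2 : i = q <;> by_cases h3 : j = p <;>
        by_cases h4 : j = q <;> grind
  have hinj : Set.InjOn f (invSet z) := by
    rintro ⟨i, j⟩ ⟨hij, -⟩ ⟨i', j'⟩ ⟨hij', -⟩ h
    simp only at hij hij'
    simp only [f] at h
    split_ifs at h <;> grind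
  have hg : Set.InjOn g S := fun r _ r' _ h => congrArg Prod.snd h
  have hgS : ∀ r ∈ S, g r ∈ invSet (z * t) := by
    intro r hr
    obtain ⟨h1, h2, h3, h4⟩ := hS r hr
    refine ⟨h1, ?_⟩
    simp only [g, Equiv.Perm.mul_apply, tp]
    rcases eq_or_ne r q with rfl | h
    · rwa [tq]
    · rw [tn r h1.ne' h]
      exact lt_of_le_of_ne h4 fun e => h (z.injective e)
  have hdisj : Disjoint (f '' invSet z) (g '' S) := by
    rw [Set.disjoint_left]
    rintro _ ⟨⟨i, j⟩, ⟨hij, hinv⟩, rfl⟩ ⟨r, hr, h⟩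
    obtain ⟨h1, h2, h3, h4⟩ := hS r hr
    simp only at hij hinv
    simp only [f, g] at h
    split_ifs at h
    · obtain ⟨hi, hj⟩ := Prod.mk.inj h
      obtain rfl : i = q := t.injective (hi.symm.trans tq.symm)
      rw [tn j (hpq.trans hij).ne' hij.ne'] at hj
      exact (hij.trans_le (hj ▸ h2)).false
    · grind
  have hfin := finite_invSet hz
  have hfin' : (invSet (z * t)).Finite := finite_invSet (hz.mul_tr p q)
  have hSfin : S.Finite := (Set.finite_Iic q).subset fun r hr => (hS r hr).2.1
  calc len z + S.ncard = (f '' invSet z).ncard + (g '' S).ncard := by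
        rw [hinj.ncard_image, hg.ncard_image, len]
    _ = (f '' invSet z ∪ g '' S).ncard :=
        (Set.ncard_union_eq hdisj (hfin.image f) (hSfin.image g)).symm
    _ ≤ (invSet (z * t)).ncard := by
        refine Set.ncard_le_ncard (Set.union_subset ?_ ?_) hfin'
        · exact Set.image_subset_iff.mpr hf
        · exact Set.image_subset_iff.mpr hgS

theorem lt_of_len_mul_tr {z : PPerm} (hz : HasFinSupp z) {p q : ℕ+} (hpq : p < q)
    (hlen : len (z * tr p q) = len z + 1) : z p < z q := by
  by_contra! h
  have hlt : z q < z p := lt_of_le_of_ne h fun e => hpq.ne' (z.injective e)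
  have := len_add_ncard_le (hz.mul_tr p q) hpq (S := ∅) (by simpa [tr] using hlt) (by simp)
  rw [mul_assoc, show tr p q * tr p q = 1 from Equiv.swap_mul_self p q, mul_one, hlen] at this
  omega

theorem not_between_of_len_mul_tr {z : PPerm} (hz : HasFinSupp z) {p q r : ℕ+}
    (hlen : len (z * tr p q) = len z + 1) (hpr : p < r) (hrq : r < q) (h : z p < z r) :
    z q < z r := by
  by_contra! hle
  have hlt := lt_of_len_mul_tr hz (hpr.trans hrq) hlen
  have := len_add_ncard_le hz (hpr.trans hrq) hlt (S := {r, q}) (by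
    rintro k (rfl | rfl)
    · exact ⟨hpr, hrq.le, h, hle⟩
    · exact ⟨hpr.trans hrq, le_rfl, hlt, le_rfl⟩)
  rw [Set.ncard_pair hrq.ne, hlen] at this
  omega

section wSeq

variable {w : PPerm} {d : ℕ} {p q : Fin d → ℕ+}

theorem wSeq_zero : wSeq w d p q 0 = w := by simp [wSeq]

theorem wSeq_succ (j : Fin d) :
    wSeq w d p q (j + 1) = wSeq w d p q j * tr (p j) (q j) := by
  have hj : (j : ℕ) < (trList d p q).length := by simp [trList]
  rw [wSeq, wSeq, List.prod_take_succ _ _ hj, mul_assoc]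
  simp [trList]

theorem wSeq_succ_left (j : Fin d) :
    wSeq w d p q (j + 1) (p j) = wSeq w d p q j (q j) := by
  simp [wSeq_succ, tr]

theorem wSeq_succ_right (j : Fin d) :
    wSeq w d p q (j + 1) (q j) = wSeq w d p q j (p j) := by
  simp [wSeq_succ, tr]

theorem wSeq_succ_of_ne (j : Fin d) {r : ℕ+} (hp : p j ≠ r) (hq : q j ≠ r) :
    wSeq w d p q (j + 1) r = wSeq w d p q j r := by
  rw [wSeq_succ, Equiv.Perm.mul_apply, tr, Equiv.swap_apply_of_ne_of_ne hp.symm hq.symm]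

theorem hasFinSupp_wSeq (hw : HasFinSupp w) {n : ℕ} (hn : n ≤ d) :
    HasFinSupp (wSeq w d p q n) := by
  induction n with
  | zero => rwa [wSeq_zero]
  | succ n ih =>
    rw [wSeq_succ ⟨n, hn⟩]
    exact (ih (by omega)).mul_tr _ _

theorem wSeq_eq_of_untouched {r : ℕ+} {s t : ℕ} (hst : s ≤ t) (ht : t ≤ d)
    (h : ∀ b : Fin d, s ≤ b → (b : ℕ) < t → p b ≠ r ∧ q b ≠ r) :
    wSeq w d p q t r = wSeq w d p q s r := by
  induction t, hst using Nat.le_induction with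
  | base => rfl
  | succ t hst ih =>
    obtain ⟨h1, h2⟩ := h ⟨t, ht⟩ hst (Nat.lt_succ_self t)
    rw [wSeq_succ_of_ne ⟨t, ht⟩ h1 h2]
    exact ih (by omega) fun b hb hb' => h b hb (by omega)

/-- The first and last transpositions moving a position determine its initial and final values. -/
theorem wSeq_first_last {r : ℕ+} {n : ℕ} (hn : n ≤ d)
    (h : ∃ b : Fin d, (b : ℕ) < n ∧ (p b = r ∨ q b = r)) :
    (∃ b : Fin d, (b : ℕ) < n ∧ (p b = r ∨ q b = r) ∧ wSeq w d p q b r = w r) ∧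
      ∃ b : Fin d, (b : ℕ) < n ∧ (p b = r ∨ q b = r) ∧
        wSeq w d p q n r = wSeq w d p q (b + 1) r := by
  let T : Finset (Fin d) := {b | (b : ℕ) < n ∧ (p b = r ∨ q b = r)}
  have hT : T.Nonempty := by
    obtain ⟨b, hb⟩ := h
    exact ⟨b, by simpa [T] using hb⟩
  have hmin := T.min'_mem hT
  have hmax := T.max'_mem hT
  simp only [T, Finset.mem_filter, Finset.mem_univ, true_and] at hmin hmax
  refine ⟨⟨_, hmin.1, hmin.2, ?_⟩, ⟨_, hmax.1, hmax.2, ?_⟩⟩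
  · rw [wSeq_eq_of_untouched (Nat.zero_le _) (by omega), wSeq_zero]
    intro b _ hb
    by_contra hne
    have : b ∈ T := by
      simp only [T, Finset.mem_filter, Finset.mem_univ, true_and]
      exact ⟨hb.trans hmin.1, by tauto⟩
    exact absurd (T.min'_le b this) (not_le.mpr hb)
  · refine wSeq_eq_of_untouched hmax.1 hn fun b hb hbn => ?_
    by_contra hne
    have : b ∈ T := by
      simp only [T, Finset.mem_filter, Finset.mem_univ, true_and]
      exact ⟨hbn, by tauto⟩
    exact absurd (T.le_max' b this) (not_le.mpr hb)

theorem IsXFact.p_lt_q {i : ℕ} (hX : IsXFact w i d p q) (b c : Fin d) : p b < q c :=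
  PNat.coe_lt_coe _ _ |>.mp ((hX.1 b).1.trans_lt (hX.1 c).2)

theorem IsXFact.len_mul_tr {i : ℕ} (hX : IsXFact w i d p q) (b : Fin d) :
    len (wSeq w d p q b * tr (p b) (q b)) = len (wSeq w d p q b) + 1 := by
  rw [← wSeq_succ, hX.2.1]

theorem IsXFact.value_lt {i : ℕ} (hw : HasFinSupp w) (hX : IsXFact w i d p q) (b : Fin d) :
    wSeq w d p q b (p b) < wSeq w d p q b (q b) :=
  lt_of_len_mul_tr (hasFinSupp_wSeq hw b.2.le) (hX.p_lt_q b b) (hX.len_mul_tr b)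

theorem IsXFact.value_mono {i : ℕ} (hw : HasFinSupp w) (hX : IsXFact w i d p q) {r : ℕ+}
    (hr : ∀ b, q b ≠ r) {s t : ℕ} (hst : s ≤ t) (ht : t ≤ d) :
    wSeq w d p q s r ≤ wSeq w d p q t r := by
  induction t, hst using Nat.le_induction with
  | base => rfl
  | succ t hst ih =>
    refine (ih (by omega)).trans ?_
    by_cases h : p ⟨t, ht⟩ = r
    · subst h
      rw [wSeq_succ_left ⟨t, ht⟩]
      exact (hX.value_lt hw ⟨t, ht⟩).le
    · exact (wSeq_succ_of_ne ⟨t, ht⟩ h (hr _)).ge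

end wSeq

/-- If `ζ = t_{p₁q₁}⋯t_{p_dq_d} ∈ X_{i,d}(w)` and no `b < a` satisfies `p_b = p_a`,
then `m_{p_aq_a}(w_a) = m_{p_aq_a}(w)` and `m'_{q_ap_a}(w_a) = m'_{q_ap_a}(w)`. -/
theorem m_invariance_X (w : PPerm) (hwf : HasFinSupp w) (i d : ℕ) (hi : 1 ≤ i)
    (p q : Fin d → ℕ+) (hX : IsXFact w i d p q) (a : Fin d)
    (ha : ∀ b : Fin d, b < a → p b ≠ p a) :
    mCnt (wSeq w d p q a) (p a) (q a) = mCnt w (p a) (q a) ∧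
      m'Cnt (wSeq w d p q a) (q a) (p a) = m'Cnt w (q a) (p a) := by
  have hpq := hX.p_lt_q
  have hinc : ∀ b : Fin d, b < a → wSeq w d p q b (p b) < wSeq w d p q a (p a) :=
    fun b hb => hX.2.2 b a hb
  have hp : ∀ n ≤ (a : ℕ), wSeq w d p q n (p a) = w (p a) := fun n hn => by
    rw [wSeq_eq_of_untouched (Nat.zero_le n) (by omega), wSeq_zero]
    exact fun b _ hb => ⟨ha b (Fin.lt_def.mpr (by omega)), (hpq a b).ne'⟩
  have hlast : ∀ r : ℕ+, (∃ b : Fin d, b < a ∧ q b = r) →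
      wSeq w d p q a r < wSeq w d p q a (p a) := by
    rintro r ⟨b, hb, rfl⟩
    obtain ⟨-, c, hc, h, he⟩ := wSeq_first_last (w := w) (r := q b) a.2.le ⟨b, hb, Or.inr rfl⟩
    have hqc := h.resolve_left (hpq c b).ne
    rw [he, ← hqc, wSeq_succ_right]
    exact hinc c hc
  have hqne : ∀ b : Fin d, b < a → q b ≠ q a := fun b hb h =>
    (hX.value_lt hwf a).not_gt (hlast _ ⟨b, hb, h⟩)
  have hq : ∀ n ≤ (a : ℕ), wSeq w d p q n (q a) = w (q a) := fun n hn => by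
    rw [wSeq_eq_of_untouched (Nat.zero_le n) (by omega), wSeq_zero]
    exact fun b _ hb => ⟨(hpq b a).ne, hqne b (Fin.lt_def.mpr (by omega))⟩
  have hpa := hp a le_rfl
  have hqa := hq a le_rfl
  have hcov : ∀ (b : Fin d) (r : ℕ+), p b < r → r < q b →
      wSeq w d p q b (p b) < wSeq w d p q b r → wSeq w d p q b (q b) < wSeq w d p q b r :=
    fun b r => not_between_of_len_mul_tr (hasFinSupp_wSeq hwf b.2.le) (hX.len_mul_tr b)
  rw [hpa] at hinc hlast
  have huntouched : ∀ r, (¬ ∃ b : Fin d, (b : ℕ) < a ∧ (p b = r ∨ q b = r)) →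
      wSeq w d p q a r = w r := fun r h => by
    rw [wSeq_eq_of_untouched (Nat.zero_le _) a.2.le, wSeq_zero]
    intro b _ hb
    by_contra hne
    exact h ⟨b, hb, by tauto⟩
  constructor
  · unfold mCnt
    congr 1
    ext r
    simp only [Set.mem_ofPred_eq, hpa, hqa]
    refine and_congr_right fun hr => ?_
    by_cases ht : ∃ b : Fin d, (b : ℕ) < a ∧ (p b = r ∨ q b = r)
    · have hpr : ∀ b, p b ≠ r := fun b => ((hpq b a).trans hr).ne
      obtain ⟨b, hb, hbr, he⟩ := (wSeq_first_last (w := w) a.2.le ht).1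
      obtain rfl := hbr.resolve_left (hpr b)
      refine iff_of_false (fun h => (hlast _ ⟨b, hb, rfl⟩).not_gt h.1) ?_
      rintro ⟨h1, h2⟩
      rw [← he] at h1 h2
      have hpab : p a < p b := by
        by_contra! hle
        refine absurd (hcov b (p a) (lt_of_le_of_ne hle (ha b hb)) (hpq a b) ?_) ?_
        · rw [hp b hb.le]; exact hinc b hb
        · rw [hp b hb.le]; exact h1.not_gt
      have hu : wSeq w d p q a (p b) = wSeq w d p q b (q b) := by
        rw [wSeq_eq_of_untouched (s := b + 1) hb a.2.le, wSeq_succ_left]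
        intro c hbc hca
        refine ⟨fun hc => ?_, (hpq b c).ne'⟩
        have hm := hX.value_mono hwf (fun k => (hpq b k).ne') hbc c.2.le
        rw [wSeq_succ_left, ← hc] at hm
        exact ((h1.trans_le hm).trans (hinc c hca)).false
      have hc := hcov a (p b) hpab (hpq b a) (by rwa [hpa, hu])
      rw [hqa, hu] at hc
      exact hc.not_gt h2
    · rw [huntouched r ht]
  · unfold m'Cnt
    congr 1
    ext r
    simp only [Set.mem_ofPred_eq, hpa, hqa]
    refine and_congr_right fun hr => ?_
    by_cases ht : ∃ b : Fin d, (b : ℕ) < a ∧ (p b = r ∨ q b = r)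
    · have hqr : ∀ b, q b ≠ r := fun b => (hr.trans (hpq a b)).ne'
      obtain ⟨⟨b, hb, hbr, he⟩, c, hc, hcr, he'⟩ := wSeq_first_last (w := w) a.2.le ht
      obtain rfl := hbr.resolve_right (hqr b)
      have hcb := hcr.resolve_right (hqr c)
      refine iff_of_false ?_ fun h => ?_
      · rintro ⟨h1, -⟩
        rw [he', ← hcb, wSeq_succ_left] at h1
        rw [← hcb] at hr
        refine absurd (hcov c (p a) hr (hpq a c) ?_) ?_
        · rw [hp c hc.le]; exact hinc c hc
        · rw [hp c hc.le]; exact h1.not_gt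
      · rw [← he] at h
        exact (hinc b hb).not_gt h.1
    · rw [huntouched r ht]

end
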